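/- Let k ≥ 5 be an integer, λ₁,…,λ₇ positive real numbers, and ε > 0 sufficiently small. There is a constant C such that for all sufficiently large X and all τ with 0 < τ < 1: with P = X^{1/4−ε}, R = τ^{−2} X^{(5k−12)/(32k)} (log X)³, 𝔪 = {α ∈ ℝ : P/X < |α| < R}, and 𝔪₂ = {α ∈ 𝔪 : |S₃(λ₂α)| ≤ X^{11/36 + 2ε}}, one has ∫_{𝔪₂} |S₂(λ₁α, ρ) S₃(λ₂α) S₃(λ₃α) S₃(λ₄α) S₃(λ₅α) S₄(λ₆α) S_k(λ₇α)|² K_τ(α) dα ≤ C τ X^{13/6 + 2/k + 44/45 − 24/(25·m₁(k)) + ε}, where m₁(k) = 2⌈343k/50 − 20⌉ if k = 5 and m₁(k) = 2⌈(49k/50 − ⌊49k/50⌋/2)(⌊49k/50⌋ + 1)⌉ if k ≥ 6. -/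

import Mathlib

open MeasureTheory Finset
open scoped Classical

/-- `e(x) = exp(2πix)`. -/
noncomputable def e (x : ℝ) : ℂ := Complex.exp (2 * Real.pi * Complex.I * x)

/-- Fejér-type kernel `K_τ(α)`. -/
noncomputable def Kf (τ α : ℝ) : ℝ :=
  if α = 0 then τ ^ 2 else (Real.sin (Real.pi * τ * α) / (Real.pi * α)) ^ 2

/-- `ψ(m,z) = 1` if every prime factor of `m` is `≥ z`, else `0`. -/
noncomputable def psi (m : ℕ) (z : ℝ) : ℝ :=
  if ∀ p : ℕ, p.Prime → p ∣ m → z ≤ (p : ℝ) then 1 else 0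

/-- `z(p)` in the sieve weights. -/
noncomputable def zP (X : ℝ) (p : ℕ) : ℝ :=
  if (p : ℝ) < X ^ ((1:ℝ)/7) then X ^ ((5:ℝ)/28) * (p : ℝ) ^ (-(1:ℝ)/2)
  else if (p : ℝ) ≤ X ^ ((3:ℝ)/14) then (p : ℝ)
  else X ^ ((5:ℝ)/14) / (p : ℝ)

/-- The sieve function `ρ(m)` of Harman–Kumchev. -/
noncomputable def rho (X : ℝ) (m : ℕ) : ℝ :=
  psi m (X ^ ((5:ℝ)/42)) -
    ∑ p ∈ m.primeFactors.filter
        (fun p : ℕ => X ^ ((5:ℝ)/42) ≤ (p:ℝ) ∧ (p:ℝ) ≤ X ^ ((1:ℝ)/4)),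
      psi (m / p) (zP X p)

/-- `S_k(α) = Σ_{p ∈ [(ηX)^{1/k}, X^{1/k}]} (log p) e(p^k α)`, sum over primes. -/
noncomputable def SS (η X : ℝ) (k : ℕ) (α : ℝ) : ℂ :=
  ∑ p ∈ (Finset.Icc 1 ⌊X ^ ((1:ℝ)/(k:ℝ))⌋₊).filter
      (fun p : ℕ => p.Prime ∧ (η * X) ^ ((1:ℝ)/(k:ℝ)) ≤ (p : ℝ)),
    (Real.log p : ℂ) * e ((p : ℝ) ^ k * α)

/-- `S₂(α, ρ) = Σ_{m ∈ [(ηX)^{1/2}, X^{1/2}]} ρ(m) e(m²α)`. -/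
noncomputable def S2 (η X α : ℝ) : ℂ :=
  ∑ m ∈ (Finset.Icc 1 ⌊X ^ ((1:ℝ)/2)⌋₊).filter
      (fun m : ℕ => (η * X) ^ ((1:ℝ)/2) ≤ (m : ℝ)),
    (rho X m : ℂ) * e ((m : ℝ) ^ 2 * α)

/-- `S_r(α)` for real `r ≥ 1`. -/
noncomputable def Sr (η X r α : ℝ) : ℂ :=
  ∑ p ∈ (Finset.Icc 1 ⌊X ^ (1/r)⌋₊).filter
      (fun p : ℕ => p.Prime ∧ (η * X) ^ (1/r) ≤ (p : ℝ)),
    (Real.log p : ℂ) * e ((p : ℝ) ^ r * α)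

/-- `U_r(α)` for real `r ≥ 1`. -/
noncomputable def Ur (η X r α : ℝ) : ℂ :=
  ∑ n ∈ (Finset.Icc 1 ⌊X ^ (1/r)⌋₊).filter
      (fun n : ℕ => (η * X) ^ (1/r) ≤ (n : ℝ)),
    e ((n : ℝ) ^ r * α)

/-- Chebyshev's function `θ(x) = Σ_{p ≤ x} log p`. -/
noncomputable def theta (x : ℝ) : ℝ :=
  ∑ p ∈ (Finset.Icc 1 ⌊x⌋₊).filter Nat.Prime, Real.log p

/-- `J_r(X,h)`. -/
noncomputable def J (ε r X h : ℝ) : ℝ :=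
  ∫ x in Set.Icc (ε * X) X,
    (theta ((x + h) ^ (1/r)) - theta (x ^ (1/r)) - ((x + h) ^ (1/r) - x ^ (1/r))) ^ 2

/-- `T_n(α) = ∫_{(ηX)^{1/n}}^{X^{1/n}} e(t^n α) dt`. -/
noncomputable def T (η X : ℝ) (n : ℕ) (α : ℝ) : ℂ :=
  ∫ t in Set.Icc ((η * X) ^ ((1:ℝ)/(n:ℝ))) (X ^ ((1:ℝ)/(n:ℝ))), e (t ^ n * α)

/-- `m₁(k)`. -/
noncomputable def m1 (k : ℕ) : ℝ :=
  if k = 5 then 2 * (⌈343 * (k:ℝ) / 50 - 20⌉ : ℝ)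
  else 2 * (⌈(49 * (k:ℝ) / 50 - (⌊49 * (k:ℝ) / 50⌋ : ℝ) / 2)
      * ((⌊49 * (k:ℝ) / 50⌋ : ℝ) + 1)⌉ : ℝ)

/-- `σ(k) = 44/45 − 24/(25 m₁(k))`. -/
noncomputable def sigma' (k : ℕ) : ℝ := 44/45 - 24 / (25 * m1 k)

/-- `m(k)` depending on `δ`. -/
noncomputable def mδ (k : ℕ) (δ : ℝ) : ℝ :=
  if ⌊(k:ℝ) * δ⌋ ≤ 3 then
    2 * (⌈((k:ℝ) * δ + 1 - (⌊(k:ℝ) * δ⌋ : ℝ)) * (2:ℝ) ^ (⌊(k:ℝ) * δ - 1⌋)⌉ : ℝ)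
  else if ⌊(k:ℝ) * δ⌋ = 4 then 2 * (⌈7 * (k:ℝ) * δ - 20⌉ : ℝ)
  else 2 * (⌈((k:ℝ) * δ - (⌊(k:ℝ) * δ⌋ : ℝ)/2) * ((⌊(k:ℝ) * δ⌋ : ℝ) + 1)⌉ : ℝ)

/-- `m₂(k)`. -/
noncomputable def m2 (k : ℕ) : ℝ :=
  if k = 5 then
    2 * (⌈(2 * (k:ℝ)/3 + 1 - (⌊2 * (k:ℝ)/3⌋ : ℝ)) * (2:ℝ) ^ (⌊2 * (k:ℝ)/3⌋ - 1)⌉ : ℝ)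
  else if k ≤ 7 then 2 * (⌈14 * (k:ℝ)/3 - 20⌉ : ℝ)
  else 2 * (⌈(2 * (k:ℝ)/3 - (⌊2 * (k:ℝ)/3⌋ : ℝ)/2) * ((⌊2 * (k:ℝ)/3⌋ : ℝ) + 1)⌉ : ℝ)

lemma divisor_bound (δ : ℝ) (hδ : 0 < δ) :
    ∃ C : ℝ, 1 ≤ C ∧ ∀ n : ℕ, n ≠ 0 → (n.divisors.card : ℝ) ≤ C * (n : ℝ) ^ δ := by
  have hl2 : 0 < Real.log 2 := Real.log_pos (by norm_num)
  set K : ℝ := 1 + 1 / (δ * Real.log 2) with hK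
  have hK1 : 1 ≤ K := by
    have : 0 < 1 / (δ * Real.log 2) := by positivity
    linarith
  obtain ⟨P, hP⟩ := exists_nat_ge ((2:ℝ) ^ (1 / δ))
  refine ⟨K ^ P, one_le_pow₀ hK1, fun n hn => ?_⟩
  rw [Nat.card_divisors hn]
  push_cast
  have key : ∀ p ∈ n.primeFactors, ((n.factorization p : ℝ) + 1) ≤
      (if p < P then K else 1) * ((p : ℝ) ^ (n.factorization p)) ^ δ := by
    intro p hp
    have hpp := Nat.prime_of_mem_primeFactors hp
    set a := n.factorization p
    have hp0 : (0:ℝ) ≤ p := Nat.cast_nonneg _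
    have hp2 : (2:ℝ) ≤ p := by exact_mod_cast hpp.two_le
    have e1 : ((p : ℝ) ^ a) ^ δ = ((p:ℝ) ^ δ) ^ a := by
      rw [← Real.rpow_natCast, ← Real.rpow_mul hp0, mul_comm, Real.rpow_mul hp0, Real.rpow_natCast]
    rw [e1]
    split_ifs with h
    · have h2 : ((2:ℝ) ^ δ) ^ a ≤ ((p:ℝ) ^ δ) ^ a := by gcongr
      have h3 : 1 + a * (δ * Real.log 2) ≤ ((2:ℝ) ^ δ) ^ a := by
        rw [← Real.rpow_natCast, ← Real.rpow_mul (by norm_num), Real.rpow_def_of_pos (by norm_num)]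
        have := Real.add_one_le_exp (Real.log 2 * (δ * (a:ℝ)))
        nlinarith
      have h4 : (a:ℝ) + 1 ≤ K * (1 + a * (δ * Real.log 2)) := by
        have hne : δ * Real.log 2 ≠ 0 := by positivity
        have : K * (1 + a * (δ * Real.log 2)) = 1 + a + 1 / (δ * Real.log 2) + a * (δ * Real.log 2) := by
          rw [hK]; field_simp; ring
        have h5 : 0 ≤ 1 / (δ * Real.log 2) := by positivity
        have h6 : 0 ≤ a * (δ * Real.log 2) := by positivity
        linarith
      calc (a:ℝ) + 1 ≤ _ := h4
        _ ≤ _ := by gcongr; linarith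
    · have hPp : (2:ℝ) ^ (1/δ) ≤ p := hP.trans (by exact_mod_cast not_lt.mp h)
      have h2 : (2:ℝ) ≤ (p:ℝ) ^ δ := by
        calc (2:ℝ) = ((2:ℝ) ^ (1/δ)) ^ δ := by
              rw [← Real.rpow_mul (by norm_num)]; field_simp; simp
          _ ≤ _ := by gcongr
      rw [one_mul]
      calc (a:ℝ) + 1 ≤ (2:ℝ) ^ a := by
            have := Nat.lt_two_pow_self (n := a)
            exact_mod_cast this
        _ ≤ _ := by gcongr
  calc ∏ x ∈ n.primeFactors, ((n.factorization x : ℝ) + 1)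
      ≤ ∏ p ∈ n.primeFactors, ((if p < P then K else 1) * ((p : ℝ) ^ (n.factorization p)) ^ δ) :=
        Finset.prod_le_prod (fun _ _ => by positivity) key
    _ = (∏ p ∈ n.primeFactors, (if p < P then K else 1)) *
        (∏ p ∈ n.primeFactors, ((p : ℝ) ^ (n.factorization p))) ^ δ := by
        rw [Finset.prod_mul_distrib, Real.finsetProd_rpow _ _ (fun _ _ => by positivity)]
    _ ≤ _ := by
        have h1 : (∏ p ∈ n.primeFactors, ((p : ℝ) ^ (n.factorization p))) = n := by
          have := Nat.prod_factorization_pow_eq_self hn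
          conv_rhs => rw [← this]
          rw [Finsupp.prod]; push_cast; rfl
        rw [h1]
        gcongr
        rw [Finset.prod_ite]
        simp only [Finset.prod_const, one_pow, mul_one]
        apply pow_le_pow_right₀ hK1
        calc _ ≤ (Finset.range P).card := Finset.card_le_card (by intro x; simp)
          _ = P := by simp

noncomputable def idiv (n : ℤ) : Finset ℤ :=
  n.natAbs.divisors.image (fun d : ℕ => (d:ℤ)) ∪ n.natAbs.divisors.image (fun d : ℕ => -(d:ℤ))

lemma idiv_card (n : ℤ) : (idiv n).card ≤ 2 * n.natAbs.divisors.card := by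
  unfold idiv
  refine (Finset.card_union_le _ _).trans ?_
  have h1 := Finset.card_image_le (s := n.natAbs.divisors) (f := fun d : ℕ => (d:ℤ))
  have h2 := Finset.card_image_le (s := n.natAbs.divisors) (f := fun d : ℕ => -(d:ℤ))
  omega

lemma mem_idiv {n d : ℤ} (hn : n ≠ 0) (h : d ∣ n) : d ∈ idiv n := by
  unfold idiv
  have : d.natAbs ∈ n.natAbs.divisors := by
    simp [Nat.mem_divisors, Int.natAbs_dvd_natAbs, h, hn]
  rcases Int.natAbs_eq d with h' | h'
  · exact Finset.mem_union_left _ (Finset.mem_image.2 ⟨_, this, h'.symm⟩)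
  · exact Finset.mem_union_right _ (Finset.mem_image.2 ⟨_, this, h'.symm⟩)

/-- the fibre count -/
lemma fib_card (k N : ℕ) (hk : k = 2 ∨ k = 3) (n : ℤ) (hn : n ≠ 0) :
    (((Finset.Icc 1 N) ×ˢ (Finset.Icc 1 N)).filter
      (fun u : ℕ × ℕ => ((u.1:ℤ) ^ k - (u.2:ℤ) ^ k) = n)).card ≤ 2 * n.natAbs.divisors.card := by
  refine le_trans ?_ (idiv_card n)
  refine Finset.card_le_card_of_injOn (fun u => (u.1:ℤ) - u.2) ?_ ?_
  · rintro ⟨x, y⟩ hu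
    simp only [Finset.coe_filter, Set.mem_ofPred_eq] at hu
    exact mem_idiv hn (hu.2 ▸ sub_dvd_pow_sub_pow _ _ k)
  · rintro ⟨x, y⟩ hu ⟨x', y'⟩ hv huv
    simp only [Finset.coe_filter, Set.mem_ofPred_eq, Finset.mem_product, Finset.mem_Icc] at hu hv huv
    obtain ⟨⟨⟨hx, -⟩, ⟨hy, -⟩⟩, hu⟩ := hu
    obtain ⟨⟨⟨hx', -⟩, ⟨hy', -⟩⟩, hv⟩ := hv
    zify at hx hy hx' hy'
    have hd : (x:ℤ) - y ≠ 0 := by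
      intro h0
      have : (x:ℤ) = y := by linarith
      rw [this] at hu; simp at hu; exact hn hu.symm
    have hxe : (x:ℤ) = y + (x' - y') := by linarith
    have hyy : (y:ℤ) = y' := by
      have hd' : (x':ℤ) - y' ≠ 0 := by rwa [← huv]
      rcases hk with rfl | rfl
      · have : ((x':ℤ) - y') * (2 * ((y:ℤ) - y')) = 0 := by
          rw [← hv, hxe] at hu; linear_combination hu
        rcases mul_eq_zero.1 this with h | h
        · exact absurd h hd'
        · linarith
      · have : ((x':ℤ) - y') * (3 * (((y:ℤ) - y') * (y + x'))) = 0 := by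
          rw [← hv, hxe] at hu; linear_combination hu
        rcases mul_eq_zero.1 this with h | h
        · exact absurd h hd'
        · rcases mul_eq_zero.1 (by linarith : ((y:ℤ) - y') * (y + x') = 0) with h | h <;> linarith
    have hxx : (x:ℤ) = x' := by linarith
    simp only [Prod.mk.injEq]
    exact ⟨by exact_mod_cast hxx, by exact_mod_cast hyy⟩

/-- `N²` energy -/
lemma energy4 (k N M : ℕ) (hk : k = 2 ∨ k = 3)
    (hM : ∀ n : ℕ, n ≠ 0 → n ≤ 2 * N ^ k → n.divisors.card ≤ M) :
    ((((Finset.Icc 1 N) ×ˢ (Finset.Icc 1 N)) ×ˢ ((Finset.Icc 1 N) ×ˢ (Finset.Icc 1 N))).filter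
      (fun u : (ℕ × ℕ) × (ℕ × ℕ) => ((u.1.1:ℤ) ^ k - (u.1.2:ℤ) ^ k) =
        ((u.2.1:ℤ) ^ k - (u.2.2:ℤ) ^ k))).card ≤ N ^ 2 * (1 + 2 * M) := by
  have hk0 : k ≠ 0 := by rcases hk with rfl | rfl <;> norm_num
  set I := Finset.Icc 1 N with hI
  have hIc : I.card = N := by simp [hI]
  have hsplit : (((I ×ˢ I) ×ˢ (I ×ˢ I)).filter
      (fun u : (ℕ × ℕ) × (ℕ × ℕ) => ((u.1.1:ℤ) ^ k - (u.1.2:ℤ) ^ k) =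
        ((u.2.1:ℤ) ^ k - (u.2.2:ℤ) ^ k))).card =
      ∑ v ∈ I ×ˢ I, ((I ×ˢ I).filter (fun u : ℕ × ℕ => ((u.1:ℤ) ^ k - (u.2:ℤ) ^ k) =
        ((v.1:ℤ) ^ k - (v.2:ℤ) ^ k))).card := by
    simp only [Finset.card_filter]
    rw [Finset.sum_product_right]
  rw [hsplit]
  have hb : ∀ v ∈ I ×ˢ I, ((I ×ˢ I).filter (fun u : ℕ × ℕ => ((u.1:ℤ) ^ k - (u.2:ℤ) ^ k) =
        ((v.1:ℤ) ^ k - (v.2:ℤ) ^ k))).card ≤ (if v.1 = v.2 then N else 0) + 2 * M := by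
    rintro ⟨x, y⟩ hv
    simp only [Finset.mem_product, hI, Finset.mem_Icc] at hv
    by_cases hxy : x = y
    · subst hxy
      simp only [sub_self, if_true]
      refine le_trans ?_ (Nat.le_add_right _ _)
      calc _ ≤ (I.image (fun x => (x, x))).card := by
            apply Finset.card_le_card
            rintro ⟨a, b⟩ hab
            simp only [Finset.mem_filter, Finset.mem_product] at hab
            have h1 : (a:ℤ) ^ k = (b:ℤ) ^ k := by linarith [hab.2]
            have h2 : a ^ k = b ^ k := by exact_mod_cast h1
            have h3 : a = b := Nat.pow_left_injective hk0 h2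
            subst h3
            exact Finset.mem_image.2 ⟨a, hab.1.1, rfl⟩
        _ ≤ I.card := Finset.card_image_le
        _ = N := hIc
    · simp only [hxy, if_false, zero_add]
      have hne : ((x:ℤ) ^ k - (y:ℤ) ^ k) ≠ 0 := by
        intro h
        have h1 : (x:ℤ) ^ k = (y:ℤ) ^ k := by linarith
        have h2 : x ^ k = y ^ k := by exact_mod_cast h1
        exact hxy (Nat.pow_left_injective hk0 h2)
      refine (fib_card k N hk _ hne).trans ?_
      apply Nat.mul_le_mul_left
      apply hM _ (by simpa using hne)
      have h1 : x ^ k ≤ N ^ k := Nat.pow_le_pow_left hv.1.2 k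
      have h2 : y ^ k ≤ N ^ k := Nat.pow_le_pow_left hv.2.2 k
      zify at h1 h2 ⊢
      have h3 : (0:ℤ) ≤ (x:ℤ) ^ k := by positivity
      have h4 : (0:ℤ) ≤ (y:ℤ) ^ k := by positivity
      rw [abs_le]; constructor <;> linarith
  refine (Finset.sum_le_sum hb).trans ?_
  rw [Finset.sum_add_distrib]
  have h1 : ∑ v ∈ I ×ˢ I, (if v.1 = v.2 then N else 0) = N * N := by
    rw [Finset.sum_product]
    simp [hIc]
  rw [h1]
  simp [hIc]
  nlinarith

lemma energy_cs {ι κ : Type*} (A : Finset ι) (Φ : ι → ℤ) (h : ι → κ) (H : Finset κ)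
    (hH : ∀ u ∈ A, h u ∈ H) :
    ((A ×ˢ A).filter (fun u : ι × ι => Φ u.1 = Φ u.2)).card ≤
      H.card * ((A ×ˢ A).filter (fun u : ι × ι => h u.1 = h u.2 ∧ Φ u.1 = Φ u.2)).card := by
  have e1 : ((A ×ˢ A).filter (fun u : ι × ι => Φ u.1 = Φ u.2)).card =
      ∑ n ∈ A.image Φ, (A.filter (fun u => Φ u = n)).card ^ 2 := by
    rw [Finset.card_eq_sum_card_fiberwise (f := fun u : ι × ι => Φ u.1) (t := A.image Φ)]
    · refine Finset.sum_congr rfl fun n _ => ?_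
      rw [sq, ← Finset.card_product]
      congr 1
      ext ⟨u, v⟩
      simp only [Finset.mem_filter, Finset.mem_product]
      constructor
      · rintro ⟨⟨⟨a, b⟩, c⟩, d⟩; exact ⟨⟨a, d⟩, b, c ▸ d⟩
      · rintro ⟨⟨a, d⟩, b, c⟩; exact ⟨⟨⟨a, b⟩, d.trans c.symm⟩, d⟩
    · rintro ⟨u, v⟩ hu
      simp only [Finset.coe_filter, Set.mem_ofPred_eq, Finset.mem_product] at hu
      exact Finset.mem_coe.2 (Finset.mem_image_of_mem _ hu.1.1)
  have e2 : ((A ×ˢ A).filter (fun u : ι × ι => h u.1 = h u.2 ∧ Φ u.1 = Φ u.2)).card =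
      ∑ n ∈ A.image Φ, ∑ c ∈ H, (A.filter (fun u => Φ u = n ∧ h u = c)).card ^ 2 := by
    rw [← Finset.sum_product',
      Finset.card_eq_sum_card_fiberwise (f := fun u : ι × ι => (Φ u.1, h u.1)) (t := A.image Φ ×ˢ H)]
    · refine Finset.sum_congr rfl fun n _ => ?_
      rw [sq, ← Finset.card_product]
      congr 1
      ext ⟨u, v⟩
      obtain ⟨n, c⟩ := n
      simp only [Finset.mem_filter, Finset.mem_product, Prod.mk.injEq]
      constructor
      · rintro ⟨⟨⟨a, b⟩, c, d⟩, e, f⟩; exact ⟨⟨a, e, f⟩, b, d ▸ e, c ▸ f⟩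
      · rintro ⟨⟨a, e, f⟩, b, g, i⟩; exact ⟨⟨⟨a, b⟩, f.trans i.symm, e.trans g.symm⟩, e, f⟩
    · rintro ⟨u, v⟩ hu
      simp only [Finset.coe_filter, Set.mem_ofPred_eq, Finset.mem_product] at hu
      exact Finset.mem_coe.2 (Finset.mem_product.2 ⟨Finset.mem_image_of_mem _ hu.1.1, hH _ hu.1.1⟩)
  rw [e1, e2, Finset.mul_sum]
  refine Finset.sum_le_sum fun n _ => ?_
  have e3 : (A.filter (fun u => Φ u = n)).card =
      ∑ c ∈ H, (A.filter (fun u => Φ u = n ∧ h u = c)).card := by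
    rw [Finset.card_eq_sum_card_fiberwise (f := h) (t := H)]
    · refine Finset.sum_congr rfl fun c _ => ?_
      rw [Finset.filter_filter]
    · intro u hu
      simp only [Finset.coe_filter, Set.mem_ofPred_eq] at hu
      exact hH _ hu.1
  rw [e3]
  exact sq_sum_le_card_mul_sum_sq

lemma weyl_fib (N M : ℕ) (m : ℤ) (hm : m ≠ 0) (hM : m.natAbs.divisors.card ≤ M) :
    ((((Finset.Icc 1 N) ×ˢ (Finset.Icc 1 N)) ×ˢ ((Finset.Icc 1 N) ×ˢ (Finset.Icc 1 N))).filter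
      (fun u : (ℕ × ℕ) × (ℕ × ℕ) => (u.1.1:ℤ) - u.1.2 = (u.2.1:ℤ) - u.2.2 ∧
        ((u.1.1:ℤ) ^ 3 - (u.1.2:ℤ) ^ 3) - ((u.2.1:ℤ) ^ 3 - (u.2.2:ℤ) ^ 3) = m)).card
      ≤ 4 * M ^ 2 := by
  have hc : (idiv m ×ˢ idiv m).card ≤ 4 * M ^ 2 := by
    rw [Finset.card_product]
    have := (idiv_card m).trans (Nat.mul_le_mul_left 2 hM)
    calc _ ≤ (2 * M) * (2 * M) := Nat.mul_le_mul this this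
      _ = _ := by ring
  refine le_trans ?_ hc
  refine Finset.card_le_card_of_injOn
    (fun u => ((u.1.1:ℤ) - u.1.2, (u.1.2:ℤ) - u.2.2)) ?_ ?_
  · rintro ⟨⟨y, x⟩, ⟨y', x'⟩⟩ hu
    simp only [Finset.coe_filter, Set.mem_ofPred_eq] at hu
    obtain ⟨-, h1, h2⟩ := hu
    have hy : (y':ℤ) = x' + (y - x) := by linarith
    have h3 : m = ((y:ℤ) - x) * ((x - x') * (3 * (y + x'))) := by
      rw [← h2, hy]; ring
    refine Finset.mem_coe.2 (Finset.mem_product.2 ⟨mem_idiv hm ⟨_, h3⟩, mem_idiv hm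
      ⟨((y:ℤ) - x) * (3 * (y + x')), ?_⟩⟩)
    rw [h3]; ring
  · rintro ⟨⟨y, x⟩, ⟨y', x'⟩⟩ hu ⟨⟨z, w⟩, ⟨z', w'⟩⟩ hv huv
    simp only [Finset.coe_filter, Set.mem_ofPred_eq] at hu hv
    simp only [Prod.mk.injEq] at huv
    obtain ⟨-, h1, h2⟩ := hu
    obtain ⟨-, h1', h2'⟩ := hv
    have hy' : (y':ℤ) = x' + (y - x) := by linarith
    have hz' : (z':ℤ) = w' + (z - w) := by linarith
    have h3 : m = (((y:ℤ) - x) * (x - x')) * (3 * (y + x')) := by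
      rw [← h2, hy']; ring
    have h4 : m = (((z:ℤ) - w) * (w - w')) * (3 * (z + w')) := by
      rw [← h2', hz']; ring
    rw [← huv.1, ← huv.2] at h4
    have h5 : ((y:ℤ) - x) * (x - x') ≠ 0 := by
      intro h0; rw [h0, zero_mul] at h3; exact hm h3
    have h6 := mul_left_cancel₀ h5 (h3.symm.trans h4)
    obtain ⟨ha, hb⟩ := huv
    simp only [Prod.mk.injEq]
    refine ⟨⟨?_, ?_⟩, ?_, ?_⟩ <;> zify <;> linarith

lemma energy8 (N M : ℕ) (hM1 : 1 ≤ M)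
    (hM : ∀ n : ℕ, n ≠ 0 → n ≤ 2 * N ^ 3 → n.divisors.card ≤ M) :
    ((((Finset.Icc 1 N ×ˢ Finset.Icc 1 N) ×ˢ (Finset.Icc 1 N ×ˢ Finset.Icc 1 N)) ×ˢ
      ((Finset.Icc 1 N ×ˢ Finset.Icc 1 N) ×ˢ (Finset.Icc 1 N ×ˢ Finset.Icc 1 N))).filter
      (fun u : ((ℕ × ℕ) × (ℕ × ℕ)) × ((ℕ × ℕ) × (ℕ × ℕ)) =>
        ((u.1.1.1:ℤ) ^ 3 - (u.1.1.2:ℤ) ^ 3) + ((u.1.2.1:ℤ) ^ 3 - (u.1.2.2:ℤ) ^ 3) =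
        ((u.2.1.1:ℤ) ^ 3 - (u.2.1.2:ℤ) ^ 3) + ((u.2.2.1:ℤ) ^ 3 - (u.2.2.2:ℤ) ^ 3))).card
      ≤ 20 * N ^ 5 * M ^ 2 := by
  have hE4 := energy4 3 N M (Or.inr rfl) hM
  have hW := weyl_fib N M
  set I := Finset.Icc 1 N with hI
  have hIc : I.card = N := by simp [hI]
  set B := I ×ˢ I with hB
  have hBc : B.card = N ^ 2 := by rw [hB, Finset.card_product, hIc, sq]
  set q : ℕ × ℕ → ℤ := fun w => (w.1:ℤ) ^ 3 - (w.2:ℤ) ^ 3 with hq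
  refine (energy_cs (B ×ˢ B) (fun u => q u.1 + q u.2) (fun u => (u.1.1:ℤ) - u.1.2)
    (Finset.Icc (-(N:ℤ) + 1) N) ?_).trans ?_
  · rintro ⟨⟨a, b⟩, c⟩ hu
    simp only [hB, hI, Finset.mem_product, Finset.mem_Icc] at hu
    simp only [Finset.mem_Icc]
    omega
  have hHc : (Finset.Icc (-(N:ℤ) + 1) N).card = 2 * N := by
    rw [Int.card_Icc]; omega
  rw [hHc]
  have hsplit : (((B ×ˢ B) ×ˢ (B ×ˢ B)).filter
      (fun u : ((ℕ × ℕ) × (ℕ × ℕ)) × ((ℕ × ℕ) × (ℕ × ℕ)) =>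
        (u.1.1.1:ℤ) - u.1.1.2 = (u.2.1.1:ℤ) - u.2.1.2 ∧ q u.1.1 + q u.1.2 = q u.2.1 + q u.2.2)).card
      = ∑ w ∈ B ×ˢ B, ((B ×ˢ B).filter (fun u : (ℕ × ℕ) × (ℕ × ℕ) =>
          (u.1.1:ℤ) - u.1.2 = (u.2.1:ℤ) - u.2.2 ∧ q u.1 - q u.2 = q w.2 - q w.1)).card := by
    simp only [Finset.card_filter]
    simp only [Finset.sum_product (s := B ×ˢ B) (t := B ×ˢ B)]
    simp only [Finset.sum_product (s := B) (t := B)]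
    have hiff : ∀ a b c d : ℤ, (a + b = c + d) ↔ (a - c = d - b) := by
      intros; constructor <;> intro h <;> linarith
    simp only [hiff]
    calc _ = ∑ x ∈ B, ∑ y ∈ B, ∑ z ∈ B, ∑ w ∈ B, 
            (if (x.1:ℤ) - x.2 = (z.1:ℤ) - z.2 ∧ q x - q z = q w - q y then 1 else 0) := rfl
      _ = ∑ y ∈ B, ∑ x ∈ B, ∑ w ∈ B, ∑ z ∈ B, 
            (if (x.1:ℤ) - x.2 = (z.1:ℤ) - z.2 ∧ q x - q z = q w - q y then 1 else 0) := by
          rw [Finset.sum_comm]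
          refine Finset.sum_congr rfl fun y _ => Finset.sum_congr rfl fun x _ => ?_
          rw [Finset.sum_comm]
      _ = ∑ y ∈ B, ∑ w ∈ B, ∑ x ∈ B, ∑ z ∈ B, 
            (if (x.1:ℤ) - x.2 = (z.1:ℤ) - z.2 ∧ q x - q z = q w - q y then 1 else 0) := by
          refine Finset.sum_congr rfl fun y _ => ?_
          rw [Finset.sum_comm]
  have hb : ∀ w ∈ B ×ˢ B, ((B ×ˢ B).filter (fun u : (ℕ × ℕ) × (ℕ × ℕ) =>
          (u.1.1:ℤ) - u.1.2 = (u.2.1:ℤ) - u.2.2 ∧ q u.1 - q u.2 = q w.2 - q w.1)).card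
          ≤ (if q w.1 = q w.2 then 2 * N ^ 2 else 0) + 4 * M ^ 2 := by
    rintro ⟨w, w'⟩ hw
    simp only
    by_cases hww : q w = q w'
    · rw [if_pos hww]
      refine le_trans ?_ (Nat.le_add_right _ _)
      calc _ ≤ ((B.image (fun u => ((u.1, u.1), (u.2, u.2)))) ∪ (B.image (fun u => (u, u)))).card := by
            apply Finset.card_le_card
            rintro ⟨⟨y, x⟩, ⟨y', x'⟩⟩ hu
            simp only [Finset.mem_filter, Finset.mem_product, hB] at hu
            obtain ⟨⟨⟨hy, hx⟩, hy', hx'⟩, h1, h2⟩ := hu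
            have hye : (y':ℤ) = x' + (y - x) := by linarith
            have h3 : ((y:ℤ) - x) * ((x - x') * (3 * (y + x'))) = 0 := by
              have : q (y, x) - q (y', x') = 0 := by rw [h2, hww]; ring
              rw [← this, hq]; simp only; rw [hye]; ring
            have hy1 : 1 ≤ y := (Finset.mem_Icc.1 hy).1
            rw [Finset.mem_union, Finset.mem_image, Finset.mem_image]
            rcases mul_eq_zero.1 h3 with h | h
            · left
              refine ⟨(y, y'), Finset.mem_product.2 ⟨hy, hy'⟩, ?_⟩
              have e1 : y = x := by omega
              have e2 : y' = x' := by omega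
              rw [e1, e2]
            · right
              have h4 : (x:ℤ) - x' = 0 := by
                rcases mul_eq_zero.1 h with h | h
                · exact h
                · exfalso; omega
              refine ⟨(y, x), Finset.mem_product.2 ⟨hy, hx⟩, ?_⟩
              have e1 : x = x' := by omega
              have e2 : y' = y := by omega
              rw [e1, e2]
        _ ≤ B.card + B.card := (Finset.card_union_le _ _).trans
            (Nat.add_le_add Finset.card_image_le Finset.card_image_le)
        _ = 2 * N ^ 2 := by rw [hBc]; ring
    · rw [if_neg hww, zero_add]
      have hne : q w' - q w ≠ 0 := fun h => hww (by linarith)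
      refine hW _ hne (hM _ (by simpa using hne) ?_)
      obtain ⟨x, y⟩ := w
      obtain ⟨z, t⟩ := w'
      simp only [hB, hI, Finset.mem_product, Finset.mem_Icc] at hw
      have h1 : x ^ 3 ≤ N ^ 3 := Nat.pow_le_pow_left hw.1.1.2 3
      have h2 : y ^ 3 ≤ N ^ 3 := Nat.pow_le_pow_left hw.1.2.2 3
      have h3 : z ^ 3 ≤ N ^ 3 := Nat.pow_le_pow_left hw.2.1.2 3
      have h4 : t ^ 3 ≤ N ^ 3 := Nat.pow_le_pow_left hw.2.2.2 3
      have h1' : 0 ≤ x ^ 3 := by positivity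
      have h2' : 0 ≤ y ^ 3 := by positivity
      have h3' : 0 ≤ z ^ 3 := by positivity
      have h4' : 0 ≤ t ^ 3 := by positivity
      simp only [hq]
      zify at h1 h2 h3 h4 h1' h2' h3' h4' ⊢
      rw [abs_le]; constructor <;> linarith
  have hE : ∑ w ∈ B ×ˢ B, (if q w.1 = q w.2 then 2 * N ^ 2 else 0) ≤
      2 * N ^ 2 * (N ^ 2 * (1 + 2 * M)) := by
    rw [← Finset.sum_filter, Finset.sum_const, smul_eq_mul, mul_comm]
    exact Nat.mul_le_mul_left _ hE4
  have hT : ∑ w ∈ B ×ˢ B, ((B ×ˢ B).filter (fun u : (ℕ × ℕ) × (ℕ × ℕ) =>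
          (u.1.1:ℤ) - u.1.2 = (u.2.1:ℤ) - u.2.2 ∧ q u.1 - q u.2 = q w.2 - q w.1)).card
      ≤ 2 * N ^ 2 * (N ^ 2 * (1 + 2 * M)) + N ^ 4 * (4 * M ^ 2) := by
    refine (Finset.sum_le_sum hb).trans ?_
    rw [Finset.sum_add_distrib]
    refine Nat.add_le_add hE (le_of_eq ?_)
    rw [Finset.sum_const, smul_eq_mul, Finset.card_product, hBc]; ring
  have hM2 : 1 ≤ M ^ 2 := Nat.one_le_pow _ _ hM1
  have hM3 : M ≤ M ^ 2 := by nlinarith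
  calc _ ≤ 2 * N * (2 * N ^ 2 * (N ^ 2 * (1 + 2 * M)) + N ^ 4 * (4 * M ^ 2)) := by
        refine Nat.mul_le_mul_left _ (le_trans (le_of_eq ?_) (hsplit.trans_le hT))
        congr
    _ ≤ 2 * N * (2 * N ^ 2 * (N ^ 2 * (M ^ 2 + 2 * M ^ 2)) + N ^ 4 * (4 * M ^ 2)) := by gcongr
    _ = 20 * N ^ 5 * M ^ 2 := by ring

lemma e_eq (x : ℝ) : e x = ((Real.cos (2 * Real.pi * x) : ℝ) : ℂ) +
    ((Real.sin (2 * Real.pi * x) : ℝ) : ℂ) * Complex.I := by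
  unfold e
  rw [Complex.ofReal_cos, Complex.ofReal_sin, ← Complex.exp_mul_I]
  congr 1; push_cast; ring

lemma e_add (x y : ℝ) : e (x + y) = e x * e y := by
  unfold e; rw [← Complex.exp_add]; congr 1; push_cast; ring

lemma e_conj (x : ℝ) : (starRingEnd ℂ) (e x) = e (-x) := by
  unfold e; rw [← Complex.exp_conj]; congr 1
  simp only [map_mul, Complex.conj_ofReal, Complex.conj_I, map_ofNat]
  push_cast; ring

lemma e_int (n : ℤ) : e (n : ℝ) = 1 := by
  unfold e
  rw [Complex.exp_eq_one_iff]
  exact ⟨n, by push_cast; ring⟩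

lemma e_norm (x : ℝ) : ‖e x‖ = 1 := by
  unfold e
  rw [Complex.norm_exp]
  simp

lemma e_cont : Continuous e := by
  unfold e; fun_prop

lemma int_cos (n : ℤ) :
    ∫ α in (0:ℝ)..1, Real.cos (2 * Real.pi * n * α) = if n = 0 then 1 else 0 := by
  split_ifs with h
  · subst h; simp
  · have hc : (2 * Real.pi * (n:ℝ)) ≠ 0 := by
      have : (n:ℝ) ≠ 0 := by exact_mod_cast h
      have := Real.pi_ne_zero
      positivity
    rw [intervalIntegral.integral_comp_mul_left (fun x => Real.cos x) hc]
    rw [integral_cos]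
    have : Real.sin (2 * Real.pi * n * 1) = 0 := by
      have := Real.sin_int_mul_pi (2 * n)
      push_cast at this
      rw [← this]; congr 1; ring
    rw [this]; simp

lemma normsq_expand {ι : Type*} (s : Finset ι) (a : ι → ℝ) (φ : ι → ℤ) (α : ℝ) :
    ‖∑ i ∈ s, (a i : ℂ) * e ((φ i : ℝ) * α)‖ ^ 2 =
      ∑ u ∈ s ×ˢ s, a u.1 * a u.2 * Real.cos (2 * Real.pi * ((φ u.1 - φ u.2 : ℤ) : ℝ) * α) := by
  have h1 : ∑ i ∈ s, (a i : ℂ) * e ((φ i : ℝ) * α) =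
      ((∑ i ∈ s, a i * Real.cos (2 * Real.pi * (φ i * α)) : ℝ) : ℂ) +
      ((∑ i ∈ s, a i * Real.sin (2 * Real.pi * (φ i * α)) : ℝ) : ℂ) * Complex.I := by
    push_cast
    rw [Finset.sum_mul, ← Finset.sum_add_distrib]
    refine Finset.sum_congr rfl fun i _ => ?_
    rw [e_eq]; push_cast; ring
  rw [h1, ← Complex.normSq_eq_norm_sq, Complex.normSq_add_mul_I, sq, sq, Finset.sum_mul_sum,
    Finset.sum_mul_sum, Finset.sum_product, ← Finset.sum_add_distrib]
  refine Finset.sum_congr rfl fun i _ => ?_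
  rw [← Finset.sum_add_distrib]
  refine Finset.sum_congr rfl fun j _ => ?_
  have : 2 * Real.pi * ((φ i - φ j : ℤ) : ℝ) * α =
      2 * Real.pi * (φ i * α) - 2 * Real.pi * (φ j * α) := by push_cast; ring
  simp only [this, Real.cos_sub]
  ring

lemma l2_bound {ι : Type*} (s : Finset ι) (a : ι → ℝ) (φ : ι → ℤ) (A : ℝ)
    (ha : ∀ i ∈ s, |a i| ≤ A) :
    ∫ α in (0:ℝ)..1, ‖∑ i ∈ s, (a i : ℂ) * e ((φ i : ℝ) * α)‖ ^ 2 ≤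
      A ^ 2 * ((s ×ˢ s).filter (fun u : ι × ι => φ u.1 = φ u.2)).card := by
  simp_rw [normsq_expand]
  rw [intervalIntegral.integral_finsetSum]
  · simp_rw [intervalIntegral.integral_const_mul, int_cos, sub_eq_zero]
    rw [Finset.card_filter]
    push_cast
    rw [Finset.mul_sum]
    refine Finset.sum_le_sum fun u hu => ?_
    rw [Finset.mem_product] at hu
    split_ifs
    · have h1 := ha _ hu.1
      have h2 := ha _ hu.2
      calc a u.1 * a u.2 * 1 ≤ |a u.1| * |a u.2| := by rw [mul_one, ← abs_mul]; exact le_abs_self _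
        _ ≤ A * A := by gcongr; exact (abs_nonneg _).trans h1
        _ = _ := by ring
    · simp
  · intro u _
    apply Continuous.intervalIntegrable
    fun_prop

lemma mul_conj_expand {ι : Type*} (s : Finset ι) (a : ι → ℝ) (φ : ι → ℤ) (α : ℝ) :
    (∑ i ∈ s, (a i : ℂ) * e ((φ i : ℝ) * α)) *
      (starRingEnd ℂ) (∑ i ∈ s, (a i : ℂ) * e ((φ i : ℝ) * α)) =
    ∑ u ∈ s ×ˢ s, ((a u.1 * a u.2 : ℝ) : ℂ) * e (((φ u.1 - φ u.2 : ℤ) : ℝ) * α) := by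
  rw [map_sum, Finset.sum_mul_sum, Finset.sum_product]
  refine Finset.sum_congr rfl fun i _ => Finset.sum_congr rfl fun j _ => ?_
  rw [map_mul, e_conj, Complex.conj_ofReal]
  have : ((φ i - φ j : ℤ) : ℝ) * α = φ i * α + -(φ j * α) := by push_cast; ring
  simp only [this, e_add]
  push_cast; ring

lemma mul_expand {ι : Type*} (s : Finset ι) (a : ι → ℝ) (φ : ι → ℤ) (α : ℝ) :
    (∑ i ∈ s, (a i : ℂ) * e ((φ i : ℝ) * α)) * (∑ i ∈ s, (a i : ℂ) * e ((φ i : ℝ) * α)) =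
    ∑ u ∈ s ×ˢ s, ((a u.1 * a u.2 : ℝ) : ℂ) * e (((φ u.1 + φ u.2 : ℤ) : ℝ) * α) := by
  rw [Finset.sum_mul_sum, Finset.sum_product]
  refine Finset.sum_congr rfl fun i _ => Finset.sum_congr rfl fun j _ => ?_
  have : ((φ i + φ j : ℤ) : ℝ) * α = φ i * α + (φ j * α) := by push_cast; ring
  simp only [this, e_add]
  push_cast; ring

lemma mv4 (N M : ℕ) (s : Finset ℕ) (hs : s ⊆ Finset.Icc 1 N) (a : ℕ → ℝ) (A : ℝ)
    (ha : ∀ i ∈ s, |a i| ≤ A)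
    (hM : ∀ n : ℕ, n ≠ 0 → n ≤ 2 * N ^ 2 → n.divisors.card ≤ M) :
    ∫ α in (0:ℝ)..1, ‖∑ m ∈ s, (a m : ℂ) * e ((m : ℝ) ^ 2 * α)‖ ^ 4 ≤
      A ^ 4 * ((N:ℝ) ^ 2 * (1 + 2 * M)) := by
  have h0 : ∀ α : ℝ, ‖∑ m ∈ s, (a m : ℂ) * e ((m : ℝ) ^ 2 * α)‖ ^ 4 =
      ‖∑ u ∈ s ×ˢ s, ((a u.1 * a u.2 : ℝ) : ℂ) *
        e ((((u.1:ℤ) ^ 2 - (u.2:ℤ) ^ 2 : ℤ) : ℝ) * α)‖ ^ 2 := by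
    intro α
    have := mul_conj_expand s a (fun m => (m:ℤ) ^ 2) α
    rw [← this, norm_mul, RCLike.norm_conj]
    push_cast
    ring
  simp_rw [h0]
  refine (l2_bound (s ×ˢ s) (fun u => a u.1 * a u.2) (fun u => (u.1:ℤ) ^ 2 - (u.2:ℤ) ^ 2) (A ^ 2)
    ?_).trans ?_
  · intro u hu
    rw [Finset.mem_product] at hu
    have h1 := ha _ hu.1
    have h2 := ha _ hu.2
    rw [abs_mul, sq]
    gcongr
    exact (abs_nonneg _).trans h1
  · have h4 := energy4 2 N M (Or.inl rfl) hM
    have h5 : (((s ×ˢ s) ×ˢ (s ×ˢ s)).filter (fun u : (ℕ × ℕ) × (ℕ × ℕ) =>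
        ((u.1.1:ℤ) ^ 2 - (u.1.2:ℤ) ^ 2) = ((u.2.1:ℤ) ^ 2 - (u.2.2:ℤ) ^ 2))).card
        ≤ N ^ 2 * (1 + 2 * M) := by
      refine le_trans (Finset.card_le_card ?_) h4
      refine Finset.filter_subset_filter _ ?_
      exact Finset.product_subset_product (Finset.product_subset_product hs hs)
        (Finset.product_subset_product hs hs)
    have h6 : ((((s ×ˢ s) ×ˢ (s ×ˢ s)).filter (fun u : (ℕ × ℕ) × (ℕ × ℕ) =>
        ((u.1.1:ℤ) ^ 2 - (u.1.2:ℤ) ^ 2) = ((u.2.1:ℤ) ^ 2 - (u.2.2:ℤ) ^ 2))).card : ℝ)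
        ≤ (N:ℝ) ^ 2 * (1 + 2 * M) := by exact_mod_cast h5
    calc _ ≤ (A ^ 2) ^ 2 * ((N:ℝ) ^ 2 * (1 + 2 * M)) := by
          refine mul_le_mul_of_nonneg_left (le_trans (le_of_eq ?_) h6) (by positivity)
          congr
      _ = _ := by ring

lemma mv8 (N M : ℕ) (hM1 : 1 ≤ M) (s : Finset ℕ) (hs : s ⊆ Finset.Icc 1 N) (a : ℕ → ℝ) (A : ℝ)
    (ha : ∀ i ∈ s, |a i| ≤ A)
    (hM : ∀ n : ℕ, n ≠ 0 → n ≤ 2 * N ^ 3 → n.divisors.card ≤ M) :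
    ∫ α in (0:ℝ)..1, ‖∑ m ∈ s, (a m : ℂ) * e ((m : ℝ) ^ 3 * α)‖ ^ 8 ≤
      A ^ 8 * (20 * (N:ℝ) ^ 5 * (M:ℝ) ^ 2) := by
  have h0 : ∀ α : ℝ, ‖∑ m ∈ s, (a m : ℂ) * e ((m : ℝ) ^ 3 * α)‖ ^ 8 =
      ‖∑ u ∈ (s ×ˢ s) ×ˢ (s ×ˢ s), (((a u.1.1 * a u.1.2) * (a u.2.1 * a u.2.2) : ℝ) : ℂ) *
        e (((((u.1.1:ℤ) ^ 3 - (u.1.2:ℤ) ^ 3) + ((u.2.1:ℤ) ^ 3 - (u.2.2:ℤ) ^ 3) : ℤ) : ℝ) * α)‖ ^ 2 := by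
    intro α
    have h1 := mul_conj_expand s a (fun m => (m:ℤ) ^ 3) α
    have h2 := mul_expand (s ×ˢ s) (fun u => a u.1 * a u.2) (fun u => (u.1:ℤ) ^ 3 - (u.2:ℤ) ^ 3) α
    rw [← h2, ← h1, norm_mul, norm_mul, RCLike.norm_conj]
    push_cast
    ring
  simp_rw [h0]
  refine (l2_bound ((s ×ˢ s) ×ˢ (s ×ˢ s)) (fun u => (a u.1.1 * a u.1.2) * (a u.2.1 * a u.2.2))
    (fun u => ((u.1.1:ℤ) ^ 3 - (u.1.2:ℤ) ^ 3) + ((u.2.1:ℤ) ^ 3 - (u.2.2:ℤ) ^ 3)) (A ^ 4)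
    ?_).trans ?_
  · intro u hu
    simp only [Finset.mem_product] at hu
    have h1 := ha _ hu.1.1
    have h2 := ha _ hu.1.2
    have h3 := ha _ hu.2.1
    have h4 := ha _ hu.2.2
    have hA : 0 ≤ A := (abs_nonneg _).trans h1
    rw [abs_mul, abs_mul, abs_mul]
    calc _ ≤ (A * A) * (A * A) := by gcongr
      _ = _ := by ring
  · have h4 := energy8 N M hM1 hM
    have hss := Finset.product_subset_product (Finset.product_subset_product hs hs)
        (Finset.product_subset_product hs hs)
    have h5 : ((((s ×ˢ s) ×ˢ (s ×ˢ s)) ×ˢ ((s ×ˢ s) ×ˢ (s ×ˢ s))).filter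
      (fun u : ((ℕ × ℕ) × (ℕ × ℕ)) × ((ℕ × ℕ) × (ℕ × ℕ)) =>
        ((u.1.1.1:ℤ) ^ 3 - (u.1.1.2:ℤ) ^ 3) + ((u.1.2.1:ℤ) ^ 3 - (u.1.2.2:ℤ) ^ 3) =
        ((u.2.1.1:ℤ) ^ 3 - (u.2.1.2:ℤ) ^ 3) + ((u.2.2.1:ℤ) ^ 3 - (u.2.2.2:ℤ) ^ 3))).card
        ≤ 20 * N ^ 5 * M ^ 2 := by
      refine le_trans (Finset.card_le_card ?_) h4
      refine Finset.filter_subset_filter _ ?_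
      exact Finset.product_subset_product hss hss
    have h6 : (((((s ×ˢ s) ×ˢ (s ×ˢ s)) ×ˢ ((s ×ˢ s) ×ˢ (s ×ˢ s))).filter
      (fun u : ((ℕ × ℕ) × (ℕ × ℕ)) × ((ℕ × ℕ) × (ℕ × ℕ)) =>
        ((u.1.1.1:ℤ) ^ 3 - (u.1.1.2:ℤ) ^ 3) + ((u.1.2.1:ℤ) ^ 3 - (u.1.2.2:ℤ) ^ 3) =
        ((u.2.1.1:ℤ) ^ 3 - (u.2.1.2:ℤ) ^ 3) + ((u.2.2.1:ℤ) ^ 3 - (u.2.2.2:ℤ) ^ 3))).card : ℝ)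
        ≤ 20 * (N:ℝ) ^ 5 * (M:ℝ) ^ 2 := by exact_mod_cast h5
    calc _ ≤ (A ^ 4) ^ 2 * (20 * (N:ℝ) ^ 5 * (M:ℝ) ^ 2) := by
          refine mul_le_mul_of_nonneg_left (le_trans (le_of_eq ?_) h6) (by positivity)
          congr
      _ = _ := by ring

lemma Kf_nonneg (τ α : ℝ) : 0 ≤ Kf τ α := by
  unfold Kf; split_ifs <;> positivity

lemma Kf_le (τ α : ℝ) (hτ : 0 < τ) : Kf τ α ≤ 2 * τ ^ 2 * (1 + (τ * α) ^ 2)⁻¹ := by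
  have hpos : 0 < 1 + (τ * α) ^ 2 := by positivity
  rw [← div_eq_mul_inv, le_div_iff₀ hpos]
  unfold Kf
  split_ifs with h
  · subst h; nlinarith [sq_nonneg τ]
  · have hα : 0 < α ^ 2 := by positivity
    have hpi : 1 ≤ Real.pi ^ 2 := by nlinarith [Real.pi_gt_three]
    have hpi0 := Real.pi_pos
    have h1 : (Real.sin (Real.pi * τ * α) / (Real.pi * α)) ^ 2 ≤ τ ^ 2 := by
      rw [div_pow, div_le_iff₀ (by positivity)]
      have : Real.sin (Real.pi * τ * α) ^ 2 ≤ (Real.pi * τ * α) ^ 2 := by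
        rw [sq_le_sq]; exact Real.abs_sin_le_abs
      calc _ ≤ _ := this
        _ = _ := by ring
    have h2 : (Real.sin (Real.pi * τ * α) / (Real.pi * α)) ^ 2 * α ^ 2 ≤ 1 := by
      rw [div_pow, mul_pow, div_mul_eq_mul_div, div_le_one (by positivity)]
      have : Real.sin (Real.pi * τ * α) ^ 2 ≤ 1 := Real.sin_sq_le_one _
      nlinarith
    have h3 : (Real.sin (Real.pi * τ * α) / (Real.pi * α)) ^ 2 * (τ * α) ^ 2 ≤ τ ^ 2 := by
      have := mul_le_mul_of_nonneg_left h2 (sq_nonneg τ)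
      calc _ = τ ^ 2 * ((Real.sin (Real.pi * τ * α) / (Real.pi * α)) ^ 2 * α ^ 2) := by ring
        _ ≤ τ ^ 2 * 1 := this
        _ = _ := mul_one _
    linarith

lemma periodize (f : ℝ → ℝ) (hf : Continuous f) (hf0 : ∀ x, 0 ≤ f x) (hp : Function.Periodic f 1)
    (l τ : ℝ) (hl : 0 < l) (hτ : 0 < τ) (hτ1 : τ < 1) :
    ∫⁻ α : ℝ, ENNReal.ofReal (f (l * α) * Kf τ α) ≤
      ENNReal.ofReal (4 * Real.pi * (1 + 1 / l ^ 2) * τ * ∫ t in (0:ℝ)..1, f t) := by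
  set I := ∫ t in (0:ℝ)..1, f t with hI
  have hI0 : 0 ≤ I := intervalIntegral.integral_nonneg (by norm_num) (fun x _ => hf0 x)
  set w : ℝ → ℝ := fun α => 2 * τ ^ 2 * (1 + (τ * α) ^ 2)⁻¹ with hw
  have hw0 : ∀ α, 0 ≤ w α := fun α => by simp only [hw]; positivity
  have hwc : Continuous w := by
    simp only [hw]
    refine Continuous.mul continuous_const (Continuous.inv₀ (by fun_prop) fun x => by positivity)
  set c : ℝ := 2 * (1 + 1 / l ^ 2) with hc
  have hc0 : 0 ≤ c := by positivity
  have hwshift : ∀ α t : ℝ, t ∈ Set.Ioc (0:ℝ) 1 → w α ≤ c * w (α - t / l) := by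
    intro α t ht
    have hs : (t / l) ^ 2 ≤ 1 / l ^ 2 := by
      rw [div_pow]; gcongr; nlinarith [ht.1, ht.2]
    simp only [hw]
    have h1 : 0 < 1 + (τ * α) ^ 2 := by positivity
    have h2 : 0 < 1 + (τ * (α - t / l)) ^ 2 := by positivity
    have h3 : 1 + (τ * (α - t / l)) ^ 2 ≤ c * (1 + (τ * α) ^ 2) := by
      have hτ2 : τ ^ 2 ≤ 1 := by nlinarith
      have h4 : (τ * (α - t / l)) ^ 2 ≤ 2 * (τ * α) ^ 2 + 2 * (τ ^ 2 * (t / l) ^ 2) := by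
        nlinarith [sq_nonneg (τ * α + τ * (t / l))]
      have h5 : τ ^ 2 * (t / l) ^ 2 ≤ 1 / l ^ 2 := by nlinarith [sq_nonneg (t / l)]
      have h6 : 0 ≤ 1 / l ^ 2 * (τ * α) ^ 2 := by positivity
      rw [hc]; nlinarith
    have h7 : (1 + (τ * α) ^ 2)⁻¹ ≤ c * (1 + (τ * (α - t / l)) ^ 2)⁻¹ := by
      rw [← div_eq_mul_inv, le_div_iff₀ h2, inv_mul_le_iff₀ h1]
      linarith
    calc _ ≤ 2 * τ ^ 2 * (c * (1 + (τ * (α - t / l)) ^ 2)⁻¹) := by gcongr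
      _ = _ := by ring
  have hwint : ∫ x, w x = 2 * Real.pi * τ := by
    simp only [hw]
    rw [integral_const_mul, Measure.integral_comp_mul_left (fun x => (1 + x ^ 2)⁻¹),
      integral_univ_inv_one_add_sq, abs_of_pos (by positivity), smul_eq_mul]
    field_simp
  have hwi : Integrable w := by
    simp only [hw]
    exact ((integrable_inv_one_add_sq).comp_mul_left' hτ.ne').const_mul _
  have hwl : ∫⁻ x, ENNReal.ofReal (w x) = ENNReal.ofReal (2 * Real.pi * τ) := by
    rw [← hwint, ofReal_integral_eq_lintegral_ofReal hwi (Filter.Eventually.of_forall hw0)]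
  have hper : ∀ x : ℝ, ∫⁻ t in Set.Ioc (0:ℝ) 1, ENNReal.ofReal (f (x + t)) = ENNReal.ofReal I := by
    intro x
    rw [← ofReal_integral_eq_lintegral_ofReal]
    · congr 1
      rw [← intervalIntegral.integral_of_le (by norm_num),
        intervalIntegral.integral_comp_add_left (fun t => f t), hI]
      have := hp.intervalIntegral_add_eq x 0
      simpa using this
    · exact (Continuous.integrableOn_Icc (by fun_prop)).mono_set Set.Ioc_subset_Icc_self
    · exact Filter.Eventually.of_forall fun t => hf0 _
  have hfm : Measurable f := hf.measurable
  have hwm : Measurable w := hwc.measurable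
  calc ∫⁻ α : ℝ, ENNReal.ofReal (f (l * α) * Kf τ α)
      ≤ ∫⁻ α : ℝ, ∫⁻ t in Set.Ioc (0:ℝ) 1,
          ENNReal.ofReal c * (ENNReal.ofReal (f (l * α)) * ENNReal.ofReal (w (α - t / l))) := by
        refine lintegral_mono fun α => ?_
        have : ENNReal.ofReal (f (l * α) * Kf τ α) =
            ∫⁻ t in Set.Ioc (0:ℝ) 1, ENNReal.ofReal (f (l * α) * Kf τ α) := by simp
        rw [this]
        refine setLIntegral_mono' measurableSet_Ioc fun t ht => ?_
        rw [← ENNReal.ofReal_mul (hf0 _), ← ENNReal.ofReal_mul hc0]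
        apply ENNReal.ofReal_le_ofReal
        calc f (l * α) * Kf τ α ≤ f (l * α) * (c * w (α - t / l)) :=
              mul_le_mul_of_nonneg_left ((Kf_le τ α hτ).trans (hwshift α t ht)) (hf0 _)
          _ = _ := by ring
    _ = ∫⁻ t in Set.Ioc (0:ℝ) 1, ∫⁻ α : ℝ,
          ENNReal.ofReal c * (ENNReal.ofReal (f (l * α)) * ENNReal.ofReal (w (α - t / l))) := by
        rw [lintegral_lintegral_swap]
        apply Measurable.aemeasurable
        fun_prop
    _ = ∫⁻ t in Set.Ioc (0:ℝ) 1, ∫⁻ β : ℝ,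
          ENNReal.ofReal c * (ENNReal.ofReal (f (l * β + t)) * ENNReal.ofReal (w β)) := by
        refine lintegral_congr fun t => ?_
        rw [← lintegral_sub_right_eq_self (μ := volume) (fun β => ENNReal.ofReal c * (ENNReal.ofReal (f (l * β + t)) * ENNReal.ofReal (w β))) (t / l)]
        refine lintegral_congr fun α => ?_
        have : l * (α - t / l) + t = l * α := by field_simp; ring
        rw [this]
    _ = ∫⁻ β : ℝ, ∫⁻ t in Set.Ioc (0:ℝ) 1,
          ENNReal.ofReal c * (ENNReal.ofReal (f (l * β + t)) * ENNReal.ofReal (w β)) := by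
        rw [lintegral_lintegral_swap]
        apply Measurable.aemeasurable
        fun_prop
    _ = ∫⁻ β : ℝ, ENNReal.ofReal c * (ENNReal.ofReal I * ENNReal.ofReal (w β)) := by
        refine lintegral_congr fun β => ?_
        rw [lintegral_const_mul _ (by fun_prop), lintegral_mul_const _ (by fun_prop), hper]
    _ = ENNReal.ofReal c * (ENNReal.ofReal I * ENNReal.ofReal (2 * Real.pi * τ)) := by
        rw [lintegral_const_mul _ (by fun_prop), lintegral_const_mul _ (by fun_prop), hwl]
    _ = _ := by
        rw [← ENNReal.ofReal_mul hI0, ← ENNReal.ofReal_mul hc0]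
        congr 1
        rw [hc]; ring

lemma m1_ge (k : ℕ) (hk : 5 ≤ k) : 30 ≤ m1 k := by
  unfold m1
  split_ifs with h
  · subst h
    have : (14:ℤ) < ⌈343 * ((5:ℕ):ℝ) / 50 - 20⌉ := by
      rw [Int.lt_ceil]; norm_num
    have h2 : (15:ℤ) ≤ ⌈343 * ((5:ℕ):ℝ) / 50 - 20⌉ := by omega
    have h3 : ((15:ℤ):ℝ) ≤ (⌈343 * ((5:ℕ):ℝ) / 50 - 20⌉ : ℝ) := Int.cast_le.2 h2
    push_cast at h3 ⊢
    linarith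
  · have hk6 : (6:ℝ) ≤ k := by exact_mod_cast (by omega : 6 ≤ k)
    set x := 49 * (k:ℝ) / 50 with hx
    have h5 : (5:ℤ) ≤ ⌊x⌋ := by
      rw [Int.le_floor]; push_cast; rw [hx]; linarith
    have h5' : (5:ℝ) ≤ (⌊x⌋:ℝ) := by exact_mod_cast h5
    have hfl : (⌊x⌋:ℝ) ≤ x := Int.floor_le x
    have := Int.le_ceil ((x - (⌊x⌋:ℝ) / 2) * ((⌊x⌋:ℝ) + 1))
    nlinarith

lemma SS_cont (η X : ℝ) (k : ℕ) : Continuous (SS η X k) := by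
  unfold SS
  refine continuous_finsetSum _ fun p _ => continuous_const.mul (e_cont.comp (by fun_prop))

lemma SS_norm (η X : ℝ) (hX : 1 ≤ X) (k : ℕ) (hk : 1 ≤ k) (α B : ℝ) (hB : Real.log X ≤ B) :
    ‖SS η X k α‖ ≤ X ^ ((1:ℝ) / k) * B := by
  have hB0 : 0 ≤ B := (Real.log_nonneg hX).trans hB
  unfold SS
  refine (norm_sum_le _ _).trans ?_
  have hk1 : (1:ℝ) ≤ k := by exact_mod_cast hk
  calc _ ≤ ∑ p ∈ (Finset.Icc 1 ⌊X ^ ((1:ℝ)/(k:ℝ))⌋₊).filter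
          (fun p : ℕ => p.Prime ∧ (η * X) ^ ((1:ℝ)/(k:ℝ)) ≤ (p : ℝ)), B := by
        refine Finset.sum_le_sum fun p hp => ?_
        rw [Finset.mem_filter, Finset.mem_Icc] at hp
        have hp1 : (1:ℝ) ≤ p := by exact_mod_cast hp.1.1
        rw [norm_mul, e_norm, mul_one, Complex.norm_real, Real.norm_of_nonneg (Real.log_nonneg hp1)]
        refine le_trans (Real.log_le_log (by linarith) ?_) hB
        calc (p:ℝ) ≤ X ^ ((1:ℝ)/k) := (Nat.le_floor_iff (by positivity)).1 hp.1.2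
          _ ≤ X ^ (1:ℝ) := by
              apply Real.rpow_le_rpow_of_exponent_le hX
              rw [div_le_one (by linarith)]; exact hk1
          _ = X := Real.rpow_one X
    _ ≤ (⌊X ^ ((1:ℝ)/(k:ℝ))⌋₊ : ℝ) * B := by
        rw [Finset.sum_const, nsmul_eq_mul]
        gcongr
        refine (Finset.card_filter_le _ _).trans ?_
        simp
    _ ≤ _ := by
        gcongr
        exact Nat.floor_le (by positivity)

lemma psi_mem (m : ℕ) (z : ℝ) : 0 ≤ psi m z ∧ psi m z ≤ 1 := by
  unfold psi; split_ifs <;> norm_num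

lemma rho_abs (X : ℝ) (m : ℕ) (hm : m ≠ 0) : |rho X m| ≤ 1 + m.divisors.card := by
  unfold rho
  have h1 := psi_mem m (X ^ ((5:ℝ)/42))
  have h2 : 0 ≤ ∑ p ∈ m.primeFactors.filter
        (fun p : ℕ => X ^ ((5:ℝ)/42) ≤ (p:ℝ) ∧ (p:ℝ) ≤ X ^ ((1:ℝ)/4)), psi (m / p) (zP X p) :=
    Finset.sum_nonneg fun p _ => (psi_mem _ _).1
  have h3 : ∑ p ∈ m.primeFactors.filter
        (fun p : ℕ => X ^ ((5:ℝ)/42) ≤ (p:ℝ) ∧ (p:ℝ) ≤ X ^ ((1:ℝ)/4)), psi (m / p) (zP X p)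
        ≤ m.divisors.card := by
    refine (Finset.sum_le_card_nsmul _ _ 1 fun p _ => (psi_mem _ _).2).trans ?_
    rw [nsmul_eq_mul, mul_one]
    exact_mod_cast Finset.card_le_card ((Finset.filter_subset _ _).trans (fun p hp =>
      Nat.mem_divisors.2 ⟨Nat.dvd_of_mem_primeFactors hp, hm⟩))
  rw [abs_le]
  constructor <;> linarith [h1.1, h1.2]

lemma poly_periodic (s : Finset ℕ) (a : ℕ → ℂ) (k j : ℕ) :
    Function.Periodic (fun α : ℝ => ‖∑ m ∈ s, a m * e ((m : ℝ) ^ k * α)‖ ^ j) 1 := by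
  intro α
  simp only
  congr 2
  refine Finset.sum_congr rfl fun m _ => ?_
  have h : e ((m:ℝ) ^ k) = 1 := by
    have := e_int ((m:ℤ) ^ k)
    push_cast at this; exact this
  rw [mul_add, e_add, mul_one, h, mul_one]

lemma poly_cont (s : Finset ℕ) (a : ℕ → ℂ) (k j : ℕ) :
    Continuous (fun α : ℝ => ‖∑ m ∈ s, a m * e ((m : ℝ) ^ k * α)‖ ^ j) := by
  refine (Continuous.norm ?_).pow j
  exact continuous_finsetSum _ fun p _ => continuous_const.mul (e_cont.comp (by fun_prop))

lemma Kf_meas (τ : ℝ) : Measurable (Kf τ) := by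
  unfold Kf
  exact Measurable.ite (measurableSet_singleton 0) (by fun_prop) (by fun_prop)

/-- constants: for `d > 0` there is `G ≥ 1` controlling everything by `G X^d`. -/
lemma consts (d : ℝ) (hd : 0 < d) (hd1 : d ≤ 1) : ∃ G : ℝ, 1 ≤ G ∧ ∀ X : ℝ, 1 ≤ X →
    Real.log X ≤ G * X ^ d ∧
    (∃ M : ℕ, 1 ≤ M ∧ (M:ℝ) ≤ G * X ^ d ∧
      ∀ n : ℕ, n ≠ 0 → (n:ℝ) ≤ 2 * X → n.divisors.card ≤ M) ∧
    (∀ m : ℕ, m ≠ 0 → (m:ℝ) ≤ X → |rho X m| ≤ G * X ^ d) := by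
  obtain ⟨C, hC1, hC⟩ := divisor_bound d hd
  refine ⟨2 * C + 1 / d, ?_, fun X hX => ⟨?_, ?_, ?_⟩⟩
  · have : 0 < 1 / d := by positivity
    linarith
  · have h := Real.log_le_rpow_div (by linarith : (0:ℝ) ≤ X) hd
    have h2 : 0 ≤ 2 * C * X ^ d := by positivity
    calc _ ≤ _ := h
      _ = 1 / d * X ^ d := by ring
      _ ≤ _ := by rw [add_mul]; linarith
  · have hY : 1 ≤ X ^ d := Real.one_le_rpow hX hd.le
    have h2X : (2 * X) ^ d ≤ 2 * X ^ d := by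
      rw [Real.mul_rpow (by norm_num) (by linarith)]
      gcongr
      calc (2:ℝ) ^ d ≤ 2 ^ (1:ℝ) := Real.rpow_le_rpow_of_exponent_le (by norm_num) hd1
        _ = 2 := by simp
    have h2X1 : 1 ≤ (2 * X) ^ d := Real.one_le_rpow (by linarith) hd.le
    refine ⟨⌊C * (2 * X) ^ d⌋₊, ?_, ?_, ?_⟩
    · apply Nat.le_floor
      push_cast
      nlinarith
    · calc _ ≤ C * (2 * X) ^ d := Nat.floor_le (by positivity)
        _ ≤ C * (2 * X ^ d) := by gcongr
        _ = 2 * C * X ^ d := by ring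
        _ ≤ _ := by
          have : 0 ≤ 1 / d * X ^ d := by positivity
          rw [add_mul]; linarith
    · intro n hn hnX
      apply Nat.le_floor
      refine (hC n hn).trans ?_
      gcongr
  · intro m hm hmX
    have hY : 1 ≤ X ^ d := Real.one_le_rpow hX hd.le
    refine (rho_abs X m hm).trans ?_
    have h1 : (m.divisors.card : ℝ) ≤ C * X ^ d := (hC m hm).trans (by gcongr)
    have h2 : 1 ≤ C * X ^ d := by nlinarith
    have : 0 ≤ 1 / d * X ^ d := by positivity
    rw [add_mul]; linarith

lemma pointwise_ineq (X W B a b c f s q r : ℝ) (hX : 0 < X) (ha : 0 ≤ a) (hb : 0 ≤ b) (hc : 0 ≤ c)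
    (hf : 0 ≤ f) (hs : 0 ≤ s) (hq : 0 ≤ q) (hr : 0 ≤ r) 
    (hbB : b ≤ B) (hcB : c ≤ B) (hfB : f ≤ B) (hW : (a * q * r) ^ 2 ≤ W) :
    (s * a * b * c * f * q * r) ^ 2 ≤
      W * X * s ^ 4 + W * X⁻¹ * B ^ 4 * (b ^ 8 + c ^ 8 + f ^ 8) := by
  have hW0 : 0 ≤ W := (sq_nonneg _).trans hW
  have h1 : s ^ 2 * (b * c * f) ^ 2 ≤ X * s ^ 4 + X⁻¹ * (b * c * f) ^ 4 := by
    have h := sq_nonneg (X * s ^ 2 - (b * c * f) ^ 2)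
    have h2 : X * s ^ 4 + X⁻¹ * (b * c * f) ^ 4 - s ^ 2 * (b * c * f) ^ 2
        = X⁻¹ * ((X * s ^ 2 - (b * c * f) ^ 2) ^ 2 + X * s ^ 2 * (b * c * f) ^ 2) := by
      field_simp; ring
    have h3 : 0 ≤ X⁻¹ * ((X * s ^ 2 - (b * c * f) ^ 2) ^ 2 + X * s ^ 2 * (b * c * f) ^ 2) := by
      positivity
    linarith
  have h2 : (b * c * f) ^ 4 ≤ B ^ 4 * (b ^ 8 + c ^ 8 + f ^ 8) := by
    have hm : (b * c * f) ^ 4 ≤ b ^ 12 + c ^ 12 + f ^ 12 := by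
      have key : ∀ u v w : ℝ, 0 ≤ u → 0 ≤ v → 0 ≤ w → u * v * w ≤ u ^ 3 + v ^ 3 + w ^ 3 := by
        intro u v w hu hv hw
        have h1 : u ^ 3 + v ^ 3 + w ^ 3 - u * v * w = (u + v + w) * ((u - v) ^ 2 + (v - w) ^ 2 +
          (w - u) ^ 2) / 2 + 2 * (u * v * w) := by ring
        have h2 : 0 ≤ (u + v + w) * ((u - v) ^ 2 + (v - w) ^ 2 +
          (w - u) ^ 2) / 2 + 2 * (u * v * w) := by positivity
        linarith
      have := key (b ^ 4) (c ^ 4) (f ^ 4) (by positivity) (by positivity) (by positivity)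
      calc _ = b ^ 4 * c ^ 4 * f ^ 4 := by ring
        _ ≤ _ := this
        _ = _ := by ring
    have t : ∀ x : ℝ, 0 ≤ x → x ≤ B → x ^ 12 ≤ B ^ 4 * x ^ 8 := by
      intro x hx hxB
      calc x ^ 12 = x ^ 4 * x ^ 8 := by ring
        _ ≤ _ := by gcongr
    linarith [t b hb hbB, t c hc hcB, t f hf hfB]
  calc (s * a * b * c * f * q * r) ^ 2 = (a * q * r) ^ 2 * (s ^ 2 * (b * c * f) ^ 2) := by ring
    _ ≤ W * (X * s ^ 4 + X⁻¹ * (B ^ 4 * (b ^ 8 + c ^ 8 + f ^ 8))) := by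
        gcongr
        exact h1.trans (by gcongr)
    _ = _ := by ring

lemma mvS2 (η X G Y : ℝ) (hX : 1 ≤ X) (hG : 1 ≤ G * Y) (M : ℕ) (hM : (M:ℝ) ≤ G * Y)
    (hdiv : ∀ n : ℕ, n ≠ 0 → (n:ℝ) ≤ 2 * X → n.divisors.card ≤ M)
    (hrho : ∀ m : ℕ, m ≠ 0 → (m:ℝ) ≤ X → |rho X m| ≤ G * Y)
    (l τ : ℝ) (hl : 0 < l) (hτ : 0 < τ) (hτ1 : τ < 1) :
    ∫⁻ α : ℝ, ENNReal.ofReal (‖S2 η X (l * α)‖ ^ 4 * Kf τ α) ≤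
      ENNReal.ofReal (4 * Real.pi * (1 + 1 / l ^ 2) * τ * (3 * (G * Y) ^ 5 * X)) := by
  unfold S2
  set s := (Finset.Icc 1 ⌊X ^ ((1:ℝ)/2)⌋₊).filter
      (fun m : ℕ => (η * X) ^ ((1:ℝ)/2) ≤ (m : ℝ)) with hs
  refine (periodize (fun α => ‖∑ m ∈ s, (rho X m : ℂ) * e ((m : ℝ) ^ 2 * α)‖ ^ 4)
    (poly_cont s (fun m => (rho X m : ℂ)) 2 4) (fun x => by positivity)
    (poly_periodic s (fun m => (rho X m : ℂ)) 2 4) l τ hl hτ hτ1).trans ?_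
  apply ENNReal.ofReal_le_ofReal
  set N := ⌊X ^ ((1:ℝ)/2)⌋₊ with hN
  have hN1 : (N:ℝ) ≤ X ^ ((1:ℝ)/2) := Nat.floor_le (by positivity)
  have hN2 : (N:ℝ) ^ 2 ≤ X := by
    calc (N:ℝ) ^ 2 ≤ (X ^ ((1:ℝ)/2)) ^ 2 := by gcongr
      _ = X := by
        rw [← Real.rpow_natCast, ← Real.rpow_mul (by linarith)]; norm_num
  have hmv := mv4 N M s (Finset.filter_subset _ _) (fun m => rho X m) (G * Y) (by
      intro m hm
      have hm' := Finset.mem_Icc.1 (Finset.mem_of_mem_filter m hm)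
      apply hrho m (by omega)
      calc (m:ℝ) ≤ N := by exact_mod_cast hm'.2
        _ ≤ X ^ ((1:ℝ)/2) := hN1
        _ ≤ X ^ (1:ℝ) := Real.rpow_le_rpow_of_exponent_le hX (by norm_num)
        _ = X := Real.rpow_one X) (by
      intro n hn hn2
      apply hdiv n hn
      have : (n:ℝ) ≤ 2 * (N:ℝ) ^ 2 := by exact_mod_cast hn2
      linarith)
  have h1 : (G * Y) ^ 4 * ((N:ℝ) ^ 2 * (1 + 2 * M)) ≤ 3 * (G * Y) ^ 5 * X := by
    calc _ ≤ (G * Y) ^ 4 * (X * (G * Y + 2 * (G * Y))) := by gcongr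
      _ = _ := by ring
  have hpi := Real.pi_pos
  exact mul_le_mul_of_nonneg_left (hmv.trans h1) (by positivity)

lemma mvS3 (η X G Y : ℝ) (hX : 1 ≤ X) (M : ℕ) (hM1 : 1 ≤ M) (hM : (M:ℝ) ≤ G * Y)
    (hdiv : ∀ n : ℕ, n ≠ 0 → (n:ℝ) ≤ 2 * X → n.divisors.card ≤ M)
    (hlog : Real.log X ≤ G * Y)
    (l τ : ℝ) (hl : 0 < l) (hτ : 0 < τ) (hτ1 : τ < 1) :
    ∫⁻ α : ℝ, ENNReal.ofReal (‖SS η X 3 (l * α)‖ ^ 8 * Kf τ α) ≤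
      ENNReal.ofReal (4 * Real.pi * (1 + 1 / l ^ 2) * τ * (20 * (G * Y) ^ 10 * X ^ ((5:ℝ)/3))) := by
  unfold SS
  set s := (Finset.Icc 1 ⌊X ^ ((1:ℝ)/((3:ℕ):ℝ))⌋₊).filter
      (fun p : ℕ => p.Prime ∧ (η * X) ^ ((1:ℝ)/((3:ℕ):ℝ)) ≤ (p : ℝ)) with hs
  refine (periodize (fun α => ‖∑ m ∈ s, (Real.log m : ℂ) * e ((m : ℝ) ^ 3 * α)‖ ^ 8)
    (poly_cont s (fun m => (Real.log m : ℂ)) 3 8) (fun x => by positivity)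
    (poly_periodic s (fun m => (Real.log m : ℂ)) 3 8) l τ hl hτ hτ1).trans ?_
  apply ENNReal.ofReal_le_ofReal
  set N := ⌊X ^ ((1:ℝ)/((3:ℕ):ℝ))⌋₊ with hN
  have hN1 : (N:ℝ) ≤ X ^ ((1:ℝ)/3) := by
    have := Nat.floor_le (a := X ^ ((1:ℝ)/((3:ℕ):ℝ))) (by positivity)
    push_cast at this hN
    rw [hN]; exact this
  have hN3 : (N:ℝ) ^ 3 ≤ X := by
    calc (N:ℝ) ^ 3 ≤ (X ^ ((1:ℝ)/3)) ^ 3 := by gcongr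
      _ = X := by
        rw [← Real.rpow_natCast, ← Real.rpow_mul (by linarith)]; norm_num
  have hN5 : (N:ℝ) ^ 5 ≤ X ^ ((5:ℝ)/3) := by
    calc (N:ℝ) ^ 5 ≤ (X ^ ((1:ℝ)/3)) ^ 5 := by gcongr
      _ = _ := by
        rw [← Real.rpow_natCast, ← Real.rpow_mul (by linarith)]; norm_num
  have hmv := mv8 N M hM1 s (Finset.filter_subset _ _) (fun m => Real.log m) (G * Y) (by
      intro m hm
      have hm' := Finset.mem_Icc.1 (Finset.mem_of_mem_filter m hm)
      have hm1 : (1:ℝ) ≤ m := by exact_mod_cast hm'.1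
      rw [abs_of_nonneg (Real.log_nonneg hm1)]
      refine (Real.log_le_log (by linarith) ?_).trans hlog
      calc (m:ℝ) ≤ N := by exact_mod_cast hm'.2
        _ ≤ X ^ ((1:ℝ)/3) := hN1
        _ ≤ X ^ (1:ℝ) := Real.rpow_le_rpow_of_exponent_le hX (by norm_num)
        _ = X := Real.rpow_one X) (by
      intro n hn hn2
      apply hdiv n hn
      have : (n:ℝ) ≤ 2 * (N:ℝ) ^ 3 := by exact_mod_cast hn2
      linarith)
  have hG0 : 0 ≤ G * Y := (Nat.cast_nonneg M).trans hM
  have h1 : (G * Y) ^ 8 * (20 * (N:ℝ) ^ 5 * (M:ℝ) ^ 2) ≤ 20 * (G * Y) ^ 10 * X ^ ((5:ℝ)/3) := by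
    calc _ ≤ (G * Y) ^ 8 * (20 * X ^ ((5:ℝ)/3) * (G * Y) ^ 2) := by gcongr
      _ = _ := by ring
  have hpi := Real.pi_pos
  exact mul_le_mul_of_nonneg_left (hmv.trans h1) (by positivity)

lemma S2_cont (η X : ℝ) : Continuous (S2 η X) := by
  unfold S2
  refine continuous_finsetSum _ fun p _ => continuous_const.mul (e_cont.comp (by fun_prop))

/-- bound for the minor-arc piece `𝔪₂`. -/
theorem minor_arc_m2_bound (k : ℕ) (hk : 5 ≤ k)
    (l1 l2 l3 l4 l5 l6 l7 : ℝ)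
    (h1 : 0 < l1) (h2 : 0 < l2) (h3 : 0 < l3) (h4 : 0 < l4)
    (h5 : 0 < l5) (h6 : 0 < l6) (h7 : 0 < l7)
    (η : ℝ) (hη : 0 < η) (hη1 : η < 1) :
    ∃ ε₀ > (0:ℝ), ∀ ε : ℝ, 0 < ε → ε ≤ ε₀ →
    ∃ C > (0:ℝ), ∃ X₀ : ℝ, ∀ X ≥ X₀, ∀ τ : ℝ, 0 < τ → τ < 1 →
      (∫ α in {α : ℝ | X ^ ((1:ℝ)/4 - ε) / X < |α| ∧
            |α| < (1/τ^2) * X ^ ((5*(k:ℝ) - 12)/(32*(k:ℝ))) * (Real.log X) ^ 3 ∧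
            ‖SS η X 3 (l2 * α)‖ ≤ X ^ ((11:ℝ)/36 + 2*ε)},
          ‖S2 η X (l1 * α) * SS η X 3 (l2 * α) * SS η X 3 (l3 * α) *
            SS η X 3 (l4 * α) * SS η X 3 (l5 * α) * SS η X 4 (l6 * α) *
            SS η X k (l7 * α)‖ ^ 2 * Kf τ α)
        ≤ C * τ * X ^ ((13:ℝ)/6 + 2/(k:ℝ) + 44/45 - 24/(25 * m1 k) + ε) := by
  refine ⟨1/10000, by norm_num, fun ε hε hε0 => ?_⟩
  set d : ℝ := 1/50000 with hd
  obtain ⟨G, hG1, hG⟩ := consts d (by norm_num [hd]) (by norm_num [hd])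
  have hpi := Real.pi_pos
  set c : ℝ → ℝ := fun l => 4 * Real.pi * (1 + 1 / l ^ 2) with hc
  have hc0 : ∀ l, 0 < c l := fun l => by simp only [hc]; positivity
  refine ⟨20 * (c l1 + c l3 + c l4 + c l5) * G ^ 18, ?_, 1, fun X hX τ hτ hτ1 => ?_⟩
  · have := hc0 l1; have := hc0 l3; have := hc0 l4; have := hc0 l5
    positivity
  have hX1 : 1 ≤ X := hX
  have hX0 : 0 < X := by linarith
  obtain ⟨hlog, ⟨M, hM1, hM, hdiv⟩, hrho⟩ := hG X hX1
  set Y := X ^ d with hY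
  have hY1 : 1 ≤ Y := Real.one_le_rpow hX1 (by norm_num [hd])
  set g := G * Y with hg
  have hg1 : 1 ≤ g := by nlinarith
  set S : Set ℝ := {α : ℝ | X ^ ((1:ℝ)/4 - ε) / X < |α| ∧
            |α| < (1/τ^2) * X ^ ((5*(k:ℝ) - 12)/(32*(k:ℝ))) * (Real.log X) ^ 3 ∧
            ‖SS η X 3 (l2 * α)‖ ≤ X ^ ((11:ℝ)/36 + 2*ε)} with hS
  have hSS2 : Continuous (fun α : ℝ => SS η X 3 (l2 * α)) := (SS_cont η X 3).comp (by fun_prop)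
  have hSm : MeasurableSet S := by
    have hma : MeasurableSet {α : ℝ | X ^ ((1:ℝ)/4 - ε) / X < |α|} :=
      measurableSet_lt measurable_const continuous_abs.measurable
    have hmb : MeasurableSet {α : ℝ |
        |α| < (1/τ^2) * X ^ ((5*(k:ℝ) - 12)/(32*(k:ℝ))) * (Real.log X) ^ 3} :=
      measurableSet_lt continuous_abs.measurable measurable_const
    have hmc : MeasurableSet {α : ℝ | ‖SS η X 3 (l2 * α)‖ ≤ X ^ ((11:ℝ)/36 + 2*ε)} :=
      measurableSet_le hSS2.norm.measurable measurable_const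
    exact hma.inter (hmb.inter hmc)
  set B : ℝ := X ^ ((1:ℝ)/3) * g with hB
  set W : ℝ := (X ^ ((11:ℝ)/36 + 2*ε) * (X ^ ((1:ℝ)/4) * g) * (X ^ ((1:ℝ)/(k:ℝ)) * g)) ^ 2 with hW
  have hW0 : 0 ≤ W := sq_nonneg _
  have hB0 : 0 ≤ B := by positivity
  have hSS3 : ∀ β, ‖SS η X 3 β‖ ≤ B := by
    intro β
    have := SS_norm η X hX1 3 (by norm_num) β g hlog
    push_cast at this
    exact this
  have hSS4 : ∀ β, ‖SS η X 4 β‖ ≤ X ^ ((1:ℝ)/4) * g := by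
    intro β
    have := SS_norm η X hX1 4 (by norm_num) β g hlog
    push_cast at this
    exact this
  have hSSk : ∀ β, ‖SS η X k β‖ ≤ X ^ ((1:ℝ)/(k:ℝ)) * g := fun β =>
    SS_norm η X hX1 k (by omega) β g hlog
  set V := W * X⁻¹ * B ^ 4 with hV
  have hV0 : 0 ≤ V := by positivity
  set F : ℝ → ℝ → ENNReal := fun l α => ENNReal.ofReal (‖SS η X 3 (l * α)‖ ^ 8 * Kf τ α) with hF
  set E : ℝ → ENNReal := fun α => ENNReal.ofReal (‖S2 η X (l1 * α)‖ ^ 4 * Kf τ α) with hE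
  have hKm := Kf_meas τ
  have hFm : ∀ l, Measurable (F l) := by
    intro l
    have : Continuous (fun α : ℝ => SS η X 3 (l * α)) := (SS_cont η X 3).comp (by fun_prop)
    have := this.measurable
    simp only [hF]; fun_prop
  have hEm : Measurable E := by
    have : Continuous (fun α : ℝ => S2 η X (l1 * α)) := (S2_cont η X).comp (by fun_prop)
    have := this.measurable
    simp only [hE]; fun_prop
  set I4 : ℝ := 3 * g ^ 5 * X with hI4
  set I8 : ℝ := 20 * g ^ 10 * X ^ ((5:ℝ)/3) with hI8
  have hEb : ∫⁻ α, E α ≤ ENNReal.ofReal (c l1 * τ * I4) :=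
    mvS2 η X G Y hX1 hg1 M hM hdiv hrho l1 τ h1 hτ hτ1
  have hFb : ∀ l, 0 < l → ∫⁻ α, F l α ≤ ENNReal.ofReal (c l * τ * I8) := fun l hl =>
    mvS3 η X G Y hX1 M hM1 hM hdiv hlog l τ hl hτ hτ1
  have hcI4 : 0 ≤ c l1 * τ * I4 := by have := hc0 l1; positivity
  have hcI8 : ∀ l, 0 ≤ c l * τ * I8 := fun l => by have := hc0 l; positivity
  set T : ℝ := W * X * (c l1 * τ * I4) + V * (c l3 * τ * I8 + c l4 * τ * I8 + c l5 * τ * I8) with hT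
  have hT0 : 0 ≤ T := by
    have := hcI8 l3; have := hcI8 l4; have := hcI8 l5
    positivity
  have main : ∫ α in S,
          ‖S2 η X (l1 * α) * SS η X 3 (l2 * α) * SS η X 3 (l3 * α) *
            SS η X 3 (l4 * α) * SS η X 3 (l5 * α) * SS η X 4 (l6 * α) *
            SS η X k (l7 * α)‖ ^ 2 * Kf τ α ≤ T := by
    refine (le_abs_self _).trans ?_
    rw [← Real.norm_eq_abs]
    refine (norm_integral_le_lintegral_norm _).trans ?_
    apply ENNReal.toReal_le_of_le_ofReal hT0
    calc _ ≤ ∫⁻ α in S, (ENNReal.ofReal (W * X) * E α +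
            ENNReal.ofReal V * (F l3 α + F l4 α + F l5 α)) := by
          refine setLIntegral_mono' hSm fun α hα => ?_
          have hK := Kf_nonneg τ α
          rw [Real.norm_of_nonneg (by positivity)]
          simp only [hE, hF]
          rw [← ENNReal.ofReal_add (by positivity) (by positivity),
            ← ENNReal.ofReal_add (by positivity) (by positivity),
            ← ENNReal.ofReal_mul (by positivity), ← ENNReal.ofReal_mul hV0,
            ← ENNReal.ofReal_add (by positivity) (by positivity)]
          apply ENNReal.ofReal_le_ofReal
          simp only [norm_mul]
          have hpw := pointwise_ineq X W B ‖SS η X 3 (l2 * α)‖ ‖SS η X 3 (l3 * α)‖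
            ‖SS η X 3 (l4 * α)‖ ‖SS η X 3 (l5 * α)‖ ‖S2 η X (l1 * α)‖ ‖SS η X 4 (l6 * α)‖
            ‖SS η X k (l7 * α)‖ hX0 (norm_nonneg _) (norm_nonneg _) (norm_nonneg _) (norm_nonneg _)
            (norm_nonneg _) (norm_nonneg _) (norm_nonneg _) (hSS3 _) (hSS3 _) (hSS3 _) (by
              rw [hW]
              have h := hα.2.2
              have h' := hSS4 (l6 * α)
              have h'' := hSSk (l7 * α)
              gcongr)
          refine (mul_le_mul_of_nonneg_right hpw hK).trans (le_of_eq ?_)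
          rw [hV]; ring
      _ ≤ ∫⁻ α, (ENNReal.ofReal (W * X) * E α +
            ENNReal.ofReal V * (F l3 α + F l4 α + F l5 α)) := setLIntegral_le_lintegral _ _
      _ = ENNReal.ofReal (W * X) * (∫⁻ α, E α) +
            ENNReal.ofReal V * ((∫⁻ α, F l3 α) + (∫⁻ α, F l4 α) + (∫⁻ α, F l5 α)) := by
          have hm3 := hFm l3
          have hm4 := hFm l4
          have hm5 := hFm l5
          have hm34 : Measurable (fun α => F l3 α + F l4 α) := hm3.add hm4
          have hm345 : Measurable (fun α => F l3 α + F l4 α + F l5 α) := hm34.add hm5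
          rw [lintegral_add_left (hEm.const_mul _), lintegral_const_mul _ hEm,
            lintegral_const_mul _ hm345, lintegral_add_left hm34, lintegral_add_left hm3]
      _ ≤ ENNReal.ofReal (W * X) * ENNReal.ofReal (c l1 * τ * I4) +
            ENNReal.ofReal V * (ENNReal.ofReal (c l3 * τ * I8) + ENNReal.ofReal (c l4 * τ * I8)
              + ENNReal.ofReal (c l5 * τ * I8)) := by
          have := hFb l3 h3
          have := hFb l4 h4
          have := hFb l5 h5
          gcongr
      _ = ENNReal.ofReal T := by
          have := hcI8 l3; have := hcI8 l4; have := hcI8 l5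
          rw [hT, ENNReal.ofReal_add (by positivity) (by positivity),
            ENNReal.ofReal_mul (p := W * X) (by positivity), ENNReal.ofReal_mul hV0, ENNReal.ofReal_add (by positivity) (by positivity),
            ENNReal.ofReal_add (by positivity) (by positivity)]
  refine main.trans ?_
  -- now the exponents
  have hWe : W = X ^ ((11:ℝ)/18 + 4*ε + 1/2 + 2/(k:ℝ)) * g ^ 4 := by
    have e1 : X ^ ((11:ℝ)/18 + 4*ε + 1/2 + 2/(k:ℝ)) =
        (X ^ ((11:ℝ)/36 + 2*ε) * X ^ ((1:ℝ)/4) * X ^ ((1:ℝ)/(k:ℝ))) ^ 2 := by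
      rw [← Real.rpow_add hX0, ← Real.rpow_add hX0, ← Real.rpow_natCast, ← Real.rpow_mul hX0.le]
      congr 1; push_cast; ring
    rw [hW, e1]; ring
  have hX3 : X⁻¹ * (X ^ ((1:ℝ)/3)) ^ 4 * X ^ ((5:ℝ)/3) = X ^ 2 := by
    rw [← Real.rpow_natCast, ← Real.rpow_mul hX0.le, ← Real.rpow_neg_one, ← Real.rpow_add hX0,
      ← Real.rpow_add hX0, ← Real.rpow_natCast]
    norm_num
  have hVI : V * I8 = 20 * W * g ^ 14 * X ^ 2 := by
    rw [hV, hI8, hB, ← hX3]; ring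
  have hWI : W * X * I4 ≤ 20 * W * g ^ 14 * X ^ 2 := by
    have : g ^ 5 ≤ g ^ 14 := pow_le_pow_right₀ hg1 (by norm_num)
    calc W * X * I4 = 3 * W * g ^ 5 * X ^ 2 := by rw [hI4]; ring
      _ ≤ 20 * W * g ^ 14 * X ^ 2 := by gcongr; norm_num
  have hm := m1_ge k hk
  have hm' : 24 / (25 * m1 k) ≤ 24 / 750 := by
    apply div_le_div_of_nonneg_left (by norm_num) (by norm_num) (by linarith)
  calc T = (c l1 * τ) * (W * X * I4) + (c l3 + c l4 + c l5) * τ * (V * I8) := by rw [hT]; ring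
    _ ≤ (c l1 * τ) * (20 * W * g ^ 14 * X ^ 2) +
        (c l3 + c l4 + c l5) * τ * (20 * W * g ^ 14 * X ^ 2) := by
        rw [hVI]
        have := hc0 l1
        gcongr
    _ = 20 * (c l1 + c l3 + c l4 + c l5) * G ^ 18 * τ *
        (X ^ ((11:ℝ)/18 + 4*ε + 1/2 + 2/(k:ℝ)) * Y ^ 18 * X ^ 2) := by
        rw [hWe, hg]; ring
    _ ≤ _ := by
        have := hc0 l1; have := hc0 l3; have := hc0 l4; have := hc0 l5
        refine mul_le_mul_of_nonneg_left ?_ (by positivity)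
        rw [hY, ← Real.rpow_natCast, ← Real.rpow_natCast, ← Real.rpow_mul hX0.le,
          ← Real.rpow_add hX0, ← Real.rpow_add hX0]
        apply Real.rpow_le_rpow_of_exponent_le hX1
        rw [hd]; push_cast
        linarith
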